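/- Convergence to the generalized effective Hamiltonian: There exists a unique function H̄_∞ : ℝ^N → ℝ such that for every sequence {H_n} satisfying (A1)–(A4), the critical values H̄_n satisfy: for every R > 0, liminf_{n→∞} inf_{|P| ≤ R} (H̄_∞(P) − H̄_n(P)) ≥ 0, and limsup_{n→∞} sup_{P ∈ ℝ^N} (H̄_∞(P) − H̄_n(P)) ≤ 0. In particular, for every such sequence, H̄_n(P) → H̄_∞(P) as n → ∞ for each P ∈ ℝ^N. -/

import Mathlib

open Set Filter MeasureTheory

noncomputable section

abbrev Euc (N : ℕ) := EuclideanSpace ℝ (Fin N)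

def intVec {N : ℕ} (z : Fin N → ℤ) : Euc N :=
  (EuclideanSpace.equiv (Fin N) ℝ).symm (fun i => (z i : ℝ))

def IsZPeriodic {N : ℕ} (u : Euc N → ℝ) : Prop :=
  ∀ (x : Euc N) (z : Fin N → ℤ), u (x + intVec z) = u x

def IsZPeriodicH {N : ℕ} (H : Euc N → Euc N → ℝ) : Prop :=
  ∀ (x p : Euc N) (z : Fin N → ℤ), H (x + intVec z) p = H x p

def superDiff {N : ℕ} (u : Euc N → ℝ) (x : Euc N) : Set (Euc N) :=
  { q | ∃ φ : Euc N → ℝ, ContDiff ℝ 1 φ ∧ IsZPeriodic φ ∧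
        (∀ y, u y - φ y ≤ u x - φ x) ∧ q = gradient φ x }

def subDiff {N : ℕ} (u : Euc N → ℝ) (x : Euc N) : Set (Euc N) :=
  { q | ∃ φ : Euc N → ℝ, ContDiff ℝ 1 φ ∧ IsZPeriodic φ ∧
        (∀ y, u x - φ x ≤ u y - φ y) ∧ q = gradient φ x }

def IsCellSubsolution {N : ℕ} (H : Euc N → Euc N → ℝ) (P : Euc N) (a : ℝ) (u : Euc N → ℝ) : Prop :=
  ∀ x, ∀ q ∈ superDiff u x, H x (q + P) ≤ a

def IsCellSupersolution {N : ℕ} (H : Euc N → Euc N → ℝ) (P : Euc N) (a : ℝ) (u : Euc N → ℝ) : Prop :=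
  ∀ x, ∀ q ∈ subDiff u x, a ≤ H x (q + P)

def IsCellSolution {N : ℕ} (H : Euc N → Euc N → ℝ) (P : Euc N) (u : Euc N → ℝ) (a : ℝ) : Prop :=
  (∃ K : NNReal, LipschitzWith K u) ∧ IsZPeriodic u ∧
    IsCellSubsolution H P a u ∧ IsCellSupersolution H P a u

def IsCoerciveH {N : ℕ} (H : Euc N → Euc N → ℝ) : Prop :=
  ∀ C : ℝ, ∃ r : ℝ, ∀ x p : Euc N, r ≤ ‖p‖ → C ≤ H x p

lemma intVec_apply {N : ℕ} (z : Fin N → ℤ) (i : Fin N) : intVec z i = (z i : ℝ) := rfl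

/-- A smooth nonnegative periodic function vanishing exactly on the integer lattice. -/
def sinSq {N : ℕ} (z : Euc N) : ℝ := ∑ i, Real.sin (Real.pi * z i) ^ 2

lemma contDiff_sinSq {N : ℕ} : ContDiff ℝ 1 (sinSq (N := N)) := by
  unfold sinSq
  refine ContDiff.sum fun i _ => ContDiff.pow (Real.contDiff_sin.comp ?_) 2
  exact contDiff_const.mul (EuclideanSpace.proj (𝕜 := ℝ) i).contDiff

lemma isZPeriodic_sinSq {N : ℕ} : IsZPeriodic (sinSq (N := N)) := by
  intro x z
  unfold sinSq
  refine Finset.sum_congr rfl fun i _ => ?_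
  have h : Real.pi * (x + intVec z) i = Real.pi * x i + z i * Real.pi := by
    rw [PiLp.add_apply, intVec_apply]; ring
  rw [h, Real.sin_add_int_mul_pi, mul_pow]
  have : ((-1 : ℝ) ^ z i) ^ 2 = 1 := by
    rw [← zpow_natCast, ← zpow_mul, mul_comm, zpow_mul]; norm_num
  rw [this, one_mul]

lemma sinSq_zero {N : ℕ} : sinSq (0 : Euc N) = 0 := by simp [sinSq]

lemma sinSq_nonneg {N : ℕ} (z : Euc N) : 0 ≤ sinSq z :=
  Finset.sum_nonneg fun _ _ => sq_nonneg _

lemma sinSq_neg {N : ℕ} (z : Euc N) : sinSq (-z) = sinSq z := by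
  simp [sinSq]

lemma sinSq_le {N : ℕ} (z : Euc N) : sinSq z ≤ N := by
  calc sinSq z ≤ ∑ _i : Fin N, (1 : ℝ) := Finset.sum_le_sum fun i _ => Real.sin_sq_le_one _
    _ = N := by simp

lemma exists_norm_sq_le_sinSq {N : ℕ} (z : Euc N) :
    ∃ k : Fin N → ℤ, ‖z + intVec k‖ ^ 2 ≤ sinSq z := by
  refine ⟨fun i => -round (z i), ?_⟩
  rw [← isZPeriodic_sinSq z (fun i => -round (z i)), EuclideanSpace.real_norm_sq_eq]
  unfold sinSq
  refine Finset.sum_le_sum fun i _ => ?_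
  set t := (z + intVec fun i => -round (z i)) i with ht
  have h1 : |t| ≤ 1 / 2 := by
    have : t = z i - round (z i) := by
      rw [ht, PiLp.add_apply, intVec_apply]; push_cast; ring
    rw [this]; exact abs_sub_round _
  have hpi := Real.pi_pos
  have h2 := Real.mul_abs_le_abs_sin (x := Real.pi * t) (by
    rw [abs_mul, abs_of_pos hpi]; nlinarith)
  have h3 : |t| ≤ |Real.sin (Real.pi * t)| := by
    rw [abs_mul, abs_of_pos hpi] at h2
    have : 2 / Real.pi * (Real.pi * |t|) = 2 * |t| := by field_simp
    rw [this] at h2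
    linarith [abs_nonneg t]
  exact sq_le_sq.2 h3

lemma exists_norm_add_intVec_le {N : ℕ} (z : Euc N) :
    ∃ k : Fin N → ℤ, ‖z + intVec k‖ ≤ N + 1 := by
  obtain ⟨k, hk⟩ := exists_norm_sq_le_sinSq z
  refine ⟨k, ?_⟩
  have := sinSq_le z
  nlinarith [norm_nonneg (z + intVec k)]

lemma IsZPeriodic.exists_forall_le {N : ℕ} {u : Euc N → ℝ} (hp : IsZPeriodic u)
    (hu : Continuous u) : ∃ x, ∀ y, u y ≤ u x := by
  obtain ⟨x, -, hx⟩ := (isCompact_closedBall (0 : Euc N) (N + 1)).exists_isMaxOn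
    ⟨0, by simp; positivity⟩ hu.continuousOn
  refine ⟨x, fun y => ?_⟩
  obtain ⟨k, hk⟩ := exists_norm_add_intVec_le y
  rw [← hp y k]
  exact hx (by simpa using hk)

lemma IsZPeriodic.gradient_add {N : ℕ} {f : Euc N → ℝ} (hf : IsZPeriodic f) (x : Euc N)
    (z : Fin N → ℤ) : gradient f (x + intVec z) = gradient f x := by
  have h : (fun y => f (y + intVec z)) = f := funext fun y => hf y z
  unfold gradient
  rw [← fderiv_comp_add_right (intVec z), h]

lemma ContDiff.continuous_gradient {N : ℕ} {f : Euc N → ℝ} (hf : ContDiff ℝ 1 f) :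
    Continuous (gradient f) :=
  (InnerProductSpace.toDual ℝ (Euc N)).symm.continuous.comp (hf.continuous_fderiv (by norm_num))

lemma norm_gradient {N : ℕ} (f : Euc N → ℝ) (x : Euc N) : ‖gradient f x‖ = ‖fderiv ℝ f x‖ := by
  unfold gradient; simp

lemma gradient_neg' {N : ℕ} (f : Euc N → ℝ) (x : Euc N) :
    gradient (fun y => -f y) x = -gradient f x := by
  unfold gradient; simp

lemma gradient_add' {N : ℕ} {f g : Euc N → ℝ} {x : Euc N} (hf : DifferentiableAt ℝ f x)
    (hg : DifferentiableAt ℝ g x) :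
    gradient (fun y => f y + g y) x = gradient f x + gradient g x := by
  unfold gradient; rw [fderiv_fun_add hf hg]; simp

lemma gradient_eq_of_forall_sub_le {N : ℕ} {f g : Euc N → ℝ} {x : Euc N}
    (hf : DifferentiableAt ℝ f x) (hg : DifferentiableAt ℝ g x)
    (h : ∀ y, f y - g y ≤ f x - g x) : gradient f x = gradient g x := by
  have hm : IsLocalMax (fun y => f y - g y) x := Eventually.of_forall h
  have := hm.fderiv_eq_zero
  rw [fderiv_fun_sub hf hg, sub_eq_zero] at this
  unfold gradient; rw [this]

lemma gradient_sinSq_sub_self {N : ℕ} (x : Euc N) :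
    gradient (fun y => sinSq (y - x)) x = 0 := by
  have hm : IsLocalMin (fun y => sinSq (y - x)) x :=
    Eventually.of_forall fun y => by
      simp only [sub_self, sinSq_zero]; exact sinSq_nonneg _
  unfold gradient; rw [hm.fderiv_eq_zero]; simp

lemma contDiff_sinSq_sub {N : ℕ} (x : Euc N) : ContDiff ℝ 1 (fun y => sinSq (y - x)) :=
  contDiff_sinSq.comp (contDiff_id.sub contDiff_const)

lemma isZPeriodic_sinSq_sub {N : ℕ} (x : Euc N) : IsZPeriodic (fun y => sinSq (y - x)) := by
  intro y z
  have : y + intVec z - x = (y - x) + intVec z := by abel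
  simp only [this]; exact isZPeriodic_sinSq _ _

lemma zero_mem_superDiff {N : ℕ} {u : Euc N → ℝ} {x : Euc N} (hx : ∀ y, u y ≤ u x) :
    (0 : Euc N) ∈ superDiff u x :=
  ⟨fun _ => 0, contDiff_const, fun _ _ => rfl, by simpa using hx, by simp⟩

lemma mem_superDiff_neg {N : ℕ} {u : Euc N → ℝ} {x q : Euc N} (hq : q ∈ subDiff u x) :
    -q ∈ superDiff (fun y => -u y) x := by
  obtain ⟨φ, h1, h2, h3, rfl⟩ := hq
  exact ⟨fun y => -φ y, h1.neg, fun y z => by simp [h2 y z], fun y => by linarith [h3 y],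
    (gradient_neg' _ _).symm⟩

lemma mem_subDiff_of_neg {N : ℕ} {u : Euc N → ℝ} {x q : Euc N}
    (hq : q ∈ superDiff (fun y => -u y) x) : -q ∈ subDiff u x := by
  obtain ⟨φ, h1, h2, h3, rfl⟩ := hq
  exact ⟨fun y => -φ y, h1.neg, fun y z => by simp [h2 y z], fun y => by linarith [h3 y],
    (gradient_neg' _ _).symm⟩

lemma norm_le_of_mem_superDiff {N : ℕ} {u : Euc N → ℝ} {x q : Euc N} {K : NNReal}
    (hu : LipschitzWith K u) (hq : q ∈ superDiff u x) : ‖q‖ ≤ K := by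
  obtain ⟨φ, h1, -, h3, rfl⟩ := hq
  set q := gradient φ x with hqdef
  have hd : HasFDerivAt φ (fderiv ℝ φ x) x := (h1.differentiable (by norm_num) x).hasFDerivAt
  have hl : HasDerivAt (fun t : ℝ => φ (x + t • (-q))) (fderiv ℝ φ x (-q)) 0 := by
    have h := (HasDerivAt.smul_const (hasDerivAt_id (0 : ℝ)) (-q)).const_add x
    have h' := HasFDerivAt.comp_hasDerivAt (f := fun t : ℝ => x + id t • (-q)) (0 : ℝ)
      (by simpa using hd) h
    simpa [Function.comp_def] using h'
  have hinner : fderiv ℝ φ x (-q) = -(‖q‖ * ‖q‖) := by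
    rw [← inner_gradient_left, inner_neg_right, ← hqdef, real_inner_self_eq_norm_mul_norm]
  have hge : -(K * ‖q‖) ≤ fderiv ℝ φ x (-q) := by
    have ht := hl.tendsto_slope_zero_right
    refine ge_of_tendsto ht ?_
    filter_upwards [self_mem_nhdsWithin] with t ht
    have ht : 0 < t := ht
    have e1 := h3 (x + t • (-q))
    have e2 := hu.dist_le_mul (x + t • (-q)) x
    rw [Real.dist_eq, dist_eq_norm, add_sub_cancel_left, norm_smul, norm_neg,
      Real.norm_of_nonneg ht.le] at e2
    have e3 := neg_abs_le (u (x + t • (-q)) - u x)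
    simp only [zero_add, zero_smul, add_zero, smul_eq_mul]
    rw [inv_mul_eq_div, le_div_iff₀ ht]
    nlinarith
  rw [hinner] at hge
  by_contra hlt
  push Not at hlt
  have : (0 : ℝ) ≤ K := K.2
  nlinarith

lemma superDiff_stability {N : ℕ} {u : Euc N → ℝ} (hu : Continuous u) {x q : Euc N}
    (hq : q ∈ superDiff u x) {δ : ℝ} (hδ : 0 < δ) :
    ∃ η > 0, ∀ v : Euc N → ℝ, Continuous v → IsZPeriodic v → (∀ y, v y ≤ u y + η) →
      u x - η ≤ v x →
      ∃ y, ∃ q' ∈ superDiff v y, ‖y - x‖ < δ ∧ ‖q' - q‖ < δ ∧ |v y - u x| < δ := by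
  obtain ⟨φ, h1, h2, h3, rfl⟩ := hq
  set ψ : Euc N → ℝ := fun y => φ y + sinSq (y - x) with hψ
  have hψc : ContDiff ℝ 1 ψ := h1.add (contDiff_sinSq_sub x)
  have hψp : IsZPeriodic ψ := fun y z => by
    have := isZPeriodic_sinSq_sub x y z
    simp only at this
    simp only [hψ, h2 y z, this]
  have hgrad : gradient ψ x = gradient φ x := by
    rw [hψ, gradient_add' (h1.differentiable (by norm_num) x)
      ((contDiff_sinSq_sub x).differentiable (by norm_num) x), gradient_sinSq_sub_self, add_zero]
  obtain ⟨r₁, hr₁, hu'⟩ := Metric.continuousAt_iff.1 hu.continuousAt (δ / 2) (half_pos hδ)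
  obtain ⟨r₂, hr₂, hφ'⟩ := Metric.continuousAt_iff.1 (h1.continuous.continuousAt (x := x)) (δ / 2)
    (half_pos hδ)
  obtain ⟨r₃, hr₃, hψ'⟩ := Metric.continuousAt_iff.1
    (hψc.continuous_gradient.continuousAt (x := x)) δ hδ
  set r := min (min r₁ r₂) (min r₃ δ) with hr
  have hr0 : 0 < r := by simp [hr, hr₁, hr₂, hr₃, hδ]
  refine ⟨min (δ / 4) (r ^ 2 / 4), by positivity, fun v hv hvp hvu hvx => ?_⟩
  set η := min (δ / 4) (r ^ 2 / 4) with hη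
  have hη1 : η ≤ δ / 4 := min_le_left _ _
  have hη2 : η ≤ r ^ 2 / 4 := min_le_right _ _
  have hper : IsZPeriodic (fun y => v y - ψ y) := fun y z => by simp only [hvp y z, hψp y z]
  obtain ⟨y₀, hy₀⟩ := hper.exists_forall_le (hv.sub hψc.continuous)
  obtain ⟨k, hk⟩ := exists_norm_sq_le_sinSq (y₀ - x)
  set y := y₀ + intVec k with hy
  have hyx : y₀ - x + intVec k = y - x := by rw [hy]; abel
  have hS : sinSq (y - x) = sinSq (y₀ - x) := by rw [← hyx]; exact isZPeriodic_sinSq _ _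
  rw [hyx, ← hS] at hk
  have hmax : ∀ z, v z - ψ z ≤ v y - ψ y := fun z => (hy₀ z).trans (hper y₀ k).ge
  have hx := hmax x
  simp only [hψ, sub_self, sinSq_zero, add_zero] at hx
  have hd : ‖y - x‖ < r := by
    have := h3 y
    have := hvu y
    refine lt_of_pow_lt_pow_left₀ 2 hr0.le ?_
    nlinarith
  have hdr : r ≤ r₁ ∧ r ≤ r₂ ∧ r ≤ r₃ ∧ r ≤ δ :=
    ⟨(min_le_left _ _).trans (min_le_left _ _), (min_le_left _ _).trans (min_le_right _ _),
      (min_le_right _ _).trans (min_le_left _ _), (min_le_right _ _).trans (min_le_right _ _)⟩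
  have hdist : dist y x < r := by rwa [dist_eq_norm]
  have a1 := hu' (hdist.trans_le hdr.1)
  have a2 := hφ' (hdist.trans_le hdr.2.1)
  have a3 := hψ' (hdist.trans_le hdr.2.2.1)
  rw [Real.dist_eq, abs_lt] at a1 a2
  rw [dist_eq_norm, hgrad] at a3
  refine ⟨y, gradient ψ y, ⟨ψ, hψc, hψp, hmax, rfl⟩, hd.trans_le hdr.2.2.2, a3, ?_⟩
  have := sinSq_nonneg (y - x)
  have := hvu y
  rw [abs_lt]
  constructor <;> linarith

lemma gradient_comp_sub {N : ℕ} (f : Euc N → ℝ) (c x : Euc N) :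
    gradient (fun y => f (y - c)) x = gradient f (x - c) := by
  unfold gradient; rw [fderiv_comp_sub]

lemma gradient_sinSq_neg {N : ℕ} (z : Euc N) :
    gradient (sinSq (N := N)) (-z) = -gradient sinSq z := by
  have h : (fun y => sinSq (-y)) = sinSq (N := N) := funext sinSq_neg
  have h2 := fderiv_comp_smul (𝕜 := ℝ) (f := sinSq (N := N)) (x := z) (-1)
  simp only [neg_smul, one_smul, h] at h2
  unfold gradient
  rw [h2]; simp

lemma gradient_const_mul' {N : ℕ} {f : Euc N → ℝ} {x : Euc N} (B : ℝ)
    (hf : DifferentiableAt ℝ f x) : gradient (fun y => B * f y) x = B • gradient f x := by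
  unfold gradient; rw [fderiv_const_mul hf]; simp

/-- Comparison of levels of a Lipschitz subsolution and a continuous supersolution. -/
lemma level_le_of_sub_super {N : ℕ} {H : Euc N → Euc N → ℝ}
    (hH : Continuous fun q : Euc N × Euc N => H q.1 q.2) {P : Euc N}
    {a b : ℝ} {u v : Euc N → ℝ} {K : NNReal} (hu : LipschitzWith K u) (hup : IsZPeriodic u)
    (hv : Continuous v) (hvp : IsZPeriodic v) (hsub : IsCellSubsolution H P a u)
    (hsup : IsCellSupersolution H P b v) : b ≤ a := by
  by_contra! hab
  have huc := ((isCompact_closedBall (0 : Euc N) (N + 2)).prod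
    (isCompact_closedBall (0 : Euc N) (K + ‖P‖))).uniformContinuousOn_of_continuous hH.continuousOn
  obtain ⟨δ, hδ, hδH⟩ := Metric.uniformContinuousOn_iff.1 huc (b - a) (by linarith)
  set ρ := min δ 1
  have hρ : 0 < ρ := lt_min hδ one_pos
  have hK : (0 : ℝ) ≤ K := K.2
  set B : ℝ := (K + 1) / ρ with hB
  have hB0 : 0 < B := by positivity
  have hΦc : Continuous fun z : Euc N × Euc N => u z.1 - v z.2 - B * sinSq (z.2 - z.1) :=
    ((hu.continuous.comp continuous_fst).sub (hv.comp continuous_snd)).sub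
      (continuous_const.mul (contDiff_sinSq.continuous.comp (continuous_snd.sub continuous_fst)))
  have hS1 : ∀ (x y : Euc N) k, sinSq (y - (x + intVec k)) = sinSq (y - x) := fun x y k => by
    rw [← sinSq_neg, ← sinSq_neg (y - x), neg_sub, neg_sub]
    exact isZPeriodic_sinSq_sub y x k
  have hS2 : ∀ (x y : Euc N) k, sinSq (y + intVec k - x) = sinSq (y - x) := fun x y k =>
    isZPeriodic_sinSq_sub x y k
  obtain ⟨⟨x, y₀⟩, hmem, hmax⟩ := ((isCompact_closedBall (0 : Euc N) (N + 1)).prod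
    (isCompact_closedBall (0 : Euc N) (N + 1))).exists_isMaxOn
    ⟨(0, 0), by constructor <;> (simp; positivity)⟩ hΦc.continuousOn
  obtain ⟨k, hk⟩ := exists_norm_sq_le_sinSq (y₀ - x)
  set y := y₀ + intVec k with hy
  have hyx : y₀ - x + intVec k = y - x := by rw [hy]; abel
  rw [hyx, ← hS2 x y₀ k, ← hy] at hk
  have hmax' : ∀ x' y', u x' - v y' - B * sinSq (y' - x') ≤ u x - v y - B * sinSq (y - x) := by
    intro x' y'
    obtain ⟨k₁, hk₁⟩ := exists_norm_add_intVec_le x'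
    obtain ⟨k₂, hk₂⟩ := exists_norm_add_intVec_le y'
    have h := hmax (a := (x' + intVec k₁, y' + intVec k₂))
      ⟨by simpa using hk₁, by simpa using hk₂⟩
    simp only [mem_ofPred_eq] at h
    rw [hS2, hS1, hup, hvp] at h
    rw [hy, hS2, hvp]
    exact h
  have hd : ‖y - x‖ < ρ := by
    have h1 := hmax' y y
    rw [sub_self, sinSq_zero] at h1
    have h2 := hu.dist_le_mul x y
    rw [dist_comm x y, dist_eq_norm y x, Real.dist_eq] at h2
    have h3 := le_abs_self (u x - u y)
    have h4 : B * ‖y - x‖ ^ 2 ≤ K * ‖y - x‖ := by nlinarith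
    by_contra! hge
    have h5 : K + 1 ≤ B * ‖y - x‖ := by
      have : B * ρ = K + 1 := by rw [hB]; field_simp
      nlinarith
    nlinarith
  set q : Euc N := -(B • gradient sinSq (y - x)) with hq
  have hqu : q ∈ superDiff u x := by
    refine ⟨fun x' => B * sinSq (x' - y), contDiff_const.mul (contDiff_sinSq_sub y), ?_, ?_, ?_⟩
    · intro x' z
      have := isZPeriodic_sinSq_sub y x' z
      simp only at this ⊢
      rw [this]
    · intro x'
      have := hmax' x' y
      rw [← sinSq_neg (y - x'), ← sinSq_neg (y - x), neg_sub, neg_sub] at this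
      linarith
    · rw [gradient_const_mul' B ((contDiff_sinSq_sub y).differentiable (by norm_num) x),
        gradient_comp_sub, ← neg_sub y x, gradient_sinSq_neg, smul_neg]
  have hqv : q ∈ subDiff v y := by
    have hqv' : -q ∈ superDiff (fun z => -v z) y := by
      refine ⟨fun y' => B * sinSq (y' - x), contDiff_const.mul (contDiff_sinSq_sub x), ?_, ?_, ?_⟩
      · intro x' z
        have := isZPeriodic_sinSq_sub x x' z
        simp only at this ⊢
        rw [this]
      · intro y'
        linarith [hmax' x y']
      · rw [gradient_const_mul' B ((contDiff_sinSq_sub x).differentiable (by norm_num) y),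
          gradient_comp_sub, hq, neg_neg]
    simpa using mem_subDiff_of_neg hqv'
  have hqP : ‖q + P‖ ≤ K + ‖P‖ :=
    (norm_add_le _ _).trans (by linarith [norm_le_of_mem_superDiff hu hqu])
  have hxb : ‖x‖ ≤ N + 1 := by simpa using hmem.1
  have hyb : ‖y‖ ≤ N + 2 := by
    have h1 : ‖y‖ ≤ ‖x‖ + ‖y - x‖ := by
      simpa using norm_add_le x (y - x)
    have : ρ ≤ 1 := min_le_right _ _
    linarith
  have hfin := hδH (x, q + P) ⟨by simp; linarith, by simpa using hqP⟩
    (y, q + P) ⟨by simpa using hyb, by simpa using hqP⟩ (by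
      rw [Prod.dist_eq, dist_self, dist_comm, dist_eq_norm]
      exact max_lt (hd.trans_le (min_le_left _ _)) hδ)
  rw [Real.dist_eq, abs_lt] at hfin
  have := hsub x q hqu
  have := hsup y q hqv
  linarith

lemma lipschitzWith_of_eventually_le {N : ℕ} {w : Euc N → ℝ} (hw : Continuous w) {K : NNReal}
    (h : ∀ x, ∀ᶠ y in nhds x, |w y - w x| ≤ K * ‖y - x‖) : LipschitzWith K w := by
  have key : ∀ x y, w y - w x ≤ K * ‖y - x‖ := by
    intro x y
    set γ : ℝ → Euc N := fun t => x + t • (y - x) with hγ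
    have hγc : Continuous γ := by fun_prop
    have hfc : Continuous fun t => w (γ t) := hw.comp hγc
    have hb := image_le_of_liminf_slope_right_le_deriv_boundary (f := fun t => w (γ t)) (a := 0)
      (b := 1) hfc.continuousOn (B := fun t => w x + t * (K * ‖y - x‖))
      (B' := fun _ => K * ‖y - x‖) (by simp [hγ]) (by fun_prop)
      (fun t _ => by
        simpa using ((hasDerivAt_id t).mul_const (K * ‖y - x‖)).const_add (w x)
          |>.hasDerivWithinAt)
      (fun t _ r hr => by
        refine Eventually.frequently ?_
        have ev := (hγc.tendsto t).eventually (h (γ t))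
        filter_upwards [ev.filter_mono nhdsWithin_le_nhds, self_mem_nhdsWithin] with s hs hst
        have hst : 0 < s - t := sub_pos.2 hst
        refine lt_of_le_of_lt ?_ hr
        rw [slope_def_field, div_le_iff₀ hst]
        have e : γ s - γ t = (s - t) • (y - x) := by simp only [hγ, sub_smul]; abel
        rw [e, norm_smul, Real.norm_of_nonneg hst.le] at hs
        linarith [le_abs_self (w (γ s) - w (γ t))])
      (x := 1) (by simp)
    simp only [hγ, one_smul, add_sub_cancel, one_mul] at hb
    linarith
  refine LipschitzWith.of_dist_le_mul fun x y => ?_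
  rw [Real.dist_eq, dist_eq_norm, abs_le]
  have := key x y
  rw [norm_sub_rev] at this
  constructor <;> linarith [key y x]

lemma eventually_abs_sub_le_of_norm_gradient_lt {N : ℕ} {g : Euc N → ℝ} {x : Euc N} {K : NNReal}
    (hg : DifferentiableAt ℝ g x) (h : ‖gradient g x‖ < K) :
    ∀ᶠ y in nhds x, |g y - g x| ≤ K * ‖y - x‖ := by
  rw [norm_gradient] at h
  have ho := hg.hasFDerivAt.isLittleO.def (sub_pos.2 h)
  filter_upwards [ho] with y hy
  rw [Real.norm_eq_abs] at hy
  have h1 : |g y - g x| ≤ |g y - g x - fderiv ℝ g x (y - x)| + |fderiv ℝ g x (y - x)| := by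
    simpa using abs_add_le (g y - g x - fderiv ℝ g x (y - x)) (fderiv ℝ g x (y - x))
  have h2 : |fderiv ℝ g x (y - x)| ≤ ‖fderiv ℝ g x‖ * ‖y - x‖ := (fderiv ℝ g x).le_opNorm _
  linarith

/-- Perron's method for the discounted problem. -/
lemma exists_discounted_solution {N : ℕ} {H : Euc N → Euc N → ℝ}
    (hH : Continuous fun q : Euc N × Euc N => H q.1 q.2) (hHp : IsZPeriodicH H)
    {C : ℝ} {K : NNReal} (hC : ∀ x, |H x 0| ≤ C) (hK : ∀ x p, (K : ℝ) ≤ ‖p‖ → C ≤ H x p)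
    {μ : ℝ} (hμ : 0 < μ) :
    ∃ u : Euc N → ℝ, LipschitzWith K u ∧ IsZPeriodic u ∧ (∀ x, |μ * u x| ≤ C) ∧
      (∀ x, ∀ q ∈ superDiff u x, μ * u x + H x q ≤ 0) ∧
      (∀ x, ∀ q ∈ subDiff u x, 0 ≤ μ * u x + H x q) := by
  set S : Set (Euc N → ℝ) := {v | LipschitzWith K v ∧ IsZPeriodic v ∧
    ∀ x, ∀ q ∈ superDiff v x, μ * v x + H x q ≤ 0} with hS
  have hconst : (fun _ => -(C / μ)) ∈ S := by
    refine ⟨(LipschitzWith.const _).weaken zero_le, fun _ _ => rfl, fun x q hq => ?_⟩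
    have h0 : ‖q‖ ≤ 0 := by
      simpa using norm_le_of_mem_superDiff (LipschitzWith.const (-(C / μ))) hq
    rw [norm_le_zero_iff.1 h0]
    have : μ * -(C / μ) = -C := by field_simp
    linarith [le_abs_self (H x 0), hC x]
  have hub : ∀ v ∈ S, ∀ y, v y ≤ C / μ := by
    rintro v ⟨h1, h2, h3⟩ y
    obtain ⟨x, hx⟩ := h2.exists_forall_le h1.continuous
    have := h3 x 0 (zero_mem_superDiff hx)
    refine (hx y).trans ((le_div_iff₀ hμ).2 ?_)
    linarith [neg_abs_le (H x 0), hC x]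
  have hbdd : ∀ y, BddAbove (range fun v : S => v.1 y) := fun y =>
    ⟨C / μ, by rintro _ ⟨v, rfl⟩; exact hub v.1 v.2 y⟩
  have : Nonempty S := ⟨⟨_, hconst⟩⟩
  set u : Euc N → ℝ := fun y => ⨆ v : S, v.1 y with hu
  have hle : ∀ v ∈ S, ∀ y, v y ≤ u y := fun v hv y => le_ciSup (hbdd y) ⟨v, hv⟩
  have huL : LipschitzWith K u := by
    refine LipschitzWith.of_le_add_mul K fun x y => ciSup_le fun v => ?_
    have h1 := v.2.1.dist_le_mul x y
    rw [Real.dist_eq] at h1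
    linarith [le_abs_self (v.1 x - v.1 y), hle v.1 v.2 y]
  have hup : IsZPeriodic u := fun x z => by
    simp only [hu]
    exact iSup_congr fun v => v.2.2.1 x z
  have husub : ∀ x, ∀ q ∈ superDiff u x, μ * u x + H x q ≤ 0 := by
    intro x q hq
    by_contra! hpos
    have hF : Continuous fun z : Euc N × Euc N × ℝ => μ * z.2.2 + H z.1 z.2.1 := by
      have := hH.comp (continuous_fst.prodMk (continuous_fst.comp continuous_snd) :
        Continuous fun z : Euc N × Euc N × ℝ => (z.1, z.2.1))
      simp only [Function.comp_def] at this
      fun_prop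
    obtain ⟨δ, hδ, hFδ⟩ := Metric.continuousAt_iff.1 (hF.continuousAt (x := (x, q, u x))) _ hpos
    obtain ⟨η, hη, hstab⟩ := superDiff_stability huL.continuous hq hδ
    obtain ⟨v, hv⟩ := exists_lt_of_lt_ciSup (show u x - η < ⨆ v : S, v.1 x by
      change u x - η < u x; linarith)
    obtain ⟨y, q', hq', h1, h2, h3⟩ := hstab v.1 v.2.1.continuous v.2.2.1
      (fun y => by linarith [hle v.1 v.2 y]) hv.le
    have hd := hFδ (x := (y, q', v.1 y)) (by
      rw [Prod.dist_eq, Prod.dist_eq, max_lt_iff, max_lt_iff, dist_eq_norm, dist_eq_norm,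
        Real.dist_eq]
      exact ⟨h1, h2, h3⟩)
    rw [Real.dist_eq, abs_lt] at hd
    linarith [v.2.2.2 y q' hq', hd.1]
  have hulow : ∀ x, -C ≤ μ * u x := fun x => by
    have := mul_le_mul_of_nonneg_left (hle _ hconst x) hμ.le
    have e : μ * -(C / μ) = -C := by field_simp
    linarith
  have huS : u ∈ S := ⟨huL, hup, husub⟩
  refine ⟨u, huL, hup, fun x => abs_le.2 ⟨hulow x, ?_⟩, husub, ?_⟩
  · have := hub u huS x
    rw [le_div_iff₀ hμ] at this
    linarith
  intro x q hq
  by_contra! hneg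
  obtain ⟨φ, h1, h2, h3, rfl⟩ := hq
  set ψ : Euc N → ℝ := fun y => φ y + -1 * sinSq (y - x) with hψ
  have hψc : ContDiff ℝ 1 ψ := h1.add (contDiff_const.mul (contDiff_sinSq_sub x))
  have hψp : IsZPeriodic ψ := fun y z => by
    have := isZPeriodic_sinSq_sub x y z
    simp only at this
    simp only [hψ, h2 y z, this]
  have hgrad : gradient ψ x = gradient φ x := by
    have hd := (contDiff_sinSq_sub x).differentiable (by norm_num) x
    rw [hψ, gradient_add' (h1.differentiable (by norm_num) x) (hd.const_mul (-1)),
      gradient_const_mul' (-1) hd, gradient_sinSq_sub_self, smul_zero, add_zero]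
  have hψx : ψ x = φ x := by simp [hψ, sinSq_zero]
  have hnormq : ‖gradient φ x‖ < K := by
    by_contra! hge
    linarith [hK x _ hge, hulow x]
  set c := u x - φ x with hc
  have hFc : Continuous fun z : Euc N × ℝ => μ * (ψ z.1 + (c + z.2)) + H z.1 (gradient ψ z.1) := by
    have hg := hψc.continuous_gradient
    have h0 := hψc.continuous
    have := hH.comp (continuous_fst.prodMk (hg.comp continuous_fst) :
        Continuous fun z : Euc N × ℝ => (z.1, gradient ψ z.1))
    simp only [Function.comp_def] at this
    fun_prop
  have hopen : IsOpen {z : Euc N × ℝ | μ * (ψ z.1 + (c + z.2)) + H z.1 (gradient ψ z.1) < 0 ∧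
      ‖gradient ψ z.1‖ < K} :=
    (isOpen_lt hFc continuous_const).inter
      (isOpen_lt (hψc.continuous_gradient.norm.comp continuous_fst) continuous_const)
  obtain ⟨ρ, hρ, hball⟩ := Metric.isOpen_iff.1 hopen (x, 0) (by
    refine ⟨?_, ?_⟩
    · simp only [hgrad, hψx, add_zero, hc, add_sub_cancel]; exact hneg
    · simp only [hgrad]; exact hnormq)
  set δ := min (ρ / 2) (ρ ^ 2 / 2) with hδ
  have hδ0 : 0 < δ := by positivity
  have hδ1 : δ < ρ := (min_le_left _ _).trans_lt (by linarith)
  have hδ2 : δ < ρ ^ 2 := (min_le_right _ _).trans_lt (by nlinarith)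
  set g : Euc N → ℝ := fun y => ψ y + (c + δ) with hg
  have hgc : ContDiff ℝ 1 g := hψc.add contDiff_const
  have hgg : ∀ y, gradient g y = gradient ψ y := fun y => by
    simp only [hg, gradient, fderiv_add_const]
  have hgood : ∀ y, u y ≤ g y → μ * g y + H y (gradient g y) < 0 ∧ ‖gradient g y‖ < K := by
    intro y hy
    have h4 := h3 y
    obtain ⟨k, hk⟩ := exists_norm_sq_le_sinSq (y - x)
    have hle' : sinSq (y - x) ≤ δ := by simp only [hg, hψ] at hy; linarith
    have e : y - x + intVec k = y + intVec k - x := by abel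
    rw [e] at hk
    have hdist : ‖y + intVec k - x‖ < ρ := lt_of_pow_lt_pow_left₀ 2 hρ.le (by linarith)
    have hm := hball (a := (y + intVec k, δ)) (by
      rw [Metric.mem_ball, Prod.dist_eq, max_lt_iff, dist_eq_norm, Real.dist_eq, sub_zero,
        abs_of_pos hδ0]
      exact ⟨hdist, hδ1⟩)
    simp only [mem_ofPred_eq, hψp y k, hψp.gradient_add, hHp y _ k] at hm
    rw [hgg]
    exact hm
  set w : Euc N → ℝ := fun y => max (u y) (g y) with hw
  have hwS : w ∈ S := by
    refine ⟨lipschitzWith_of_eventually_le (huL.continuous.max hgc.continuous) fun y => ?_,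
      fun y z => ?_, fun y q hq => ?_⟩
    · by_cases hy : u y ≤ g y
      · filter_upwards [eventually_abs_sub_le_of_norm_gradient_lt
          (hgc.differentiable (by norm_num) y) (hgood y hy).2] with z hz
        refine (abs_max_sub_max_le_max _ _ _ _).trans (max_le ?_ hz)
        have := huL.dist_le_mul z y
        rwa [Real.dist_eq, dist_eq_norm] at this
      · push Not at hy
        filter_upwards [(isOpen_lt hgc.continuous huL.continuous).mem_nhds hy] with z hz
        have hz : g z < u z := hz
        simp only [max_eq_left hz.le, max_eq_left hy.le]
        have := huL.dist_le_mul z y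
        rwa [Real.dist_eq, dist_eq_norm] at this
    · simp only [hw, hg, hup y z, hψp y z]
    · obtain ⟨χ, c1, c2, c3, rfl⟩ := hq
      rcases le_total (g y) (u y) with hy | hy
      · have hwy : w y = u y := max_eq_left hy
        rw [hwy]
        refine husub y _ ⟨χ, c1, c2, fun z => ?_, rfl⟩
        have := c3 z
        have : u z ≤ w z := le_max_left _ _
        linarith
      · have hwy : w y = g y := max_eq_right hy
        have hgr : gradient g y = gradient χ y :=
          gradient_eq_of_forall_sub_le (hgc.differentiable (by norm_num) y)
            (c1.differentiable (by norm_num) y) fun z => by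
              have := c3 z
              have : g z ≤ w z := le_max_right _ _
              linarith
        rw [hwy, ← hgr]
        exact (hgood y hy).1.le
  have hfin := (le_max_right (u x) (g x)).trans (hle w hwS x)
  simp only [hg, hψx, hc] at hfin
  linarith

lemma level_le_of_uniform_limit {N : ℕ} {ι : Type*} {F : Filter ι} [F.NeBot]
    {G : Euc N → Euc N → ℝ} (hG : Continuous fun q : Euc N × Euc N => G q.1 q.2) {a : ℝ}
    {v : ι → Euc N → ℝ} {u : Euc N → ℝ} (hu : Continuous u) (hv : ∀ k, Continuous (v k))
    (hvp : ∀ k, IsZPeriodic (v k)) (hconv : ∀ η > 0, ∀ᶠ k in F, ∀ x, |v k x - u x| ≤ η)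
    (hsub : ∀ e > 0, ∀ᶠ k in F, ∀ y, ∀ q ∈ superDiff (v k) y, G y q ≤ a + e)
    (x q : Euc N) (hq : q ∈ superDiff u x) : G x q ≤ a := by
  refine le_of_forall_pos_le_add fun e he => ?_
  obtain ⟨δ, hδ, hGδ⟩ := Metric.continuousAt_iff.1 (hG.continuousAt (x := (x, q))) (e / 2)
    (half_pos he)
  obtain ⟨η, hη, hstab⟩ := superDiff_stability hu hq hδ
  obtain ⟨k, hk1, hk2⟩ := ((hconv η hη).and (hsub (e / 2) (half_pos he))).exists
  obtain ⟨y, q', hq', h1, h2, -⟩ := hstab (v k) (hv k) (hvp k)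
    (fun y => by linarith [(abs_le.1 (hk1 y)).2]) (by linarith [(abs_le.1 (hk1 x)).1])
  have hd := hGδ (x := (y, q')) (by
    rw [Prod.dist_eq, max_lt_iff, dist_eq_norm, dist_eq_norm]
    exact ⟨h1, h2⟩)
  rw [Real.dist_eq, abs_lt] at hd
  linarith [hk2 y q' hq', hd.1]

lemma exists_tendsto_ultrafilter {ι : Type*} (F : Ultrafilter ι) {s : ι → ℝ} {D : ℝ}
    (hs : ∀ k, |s k| ≤ D) : ∃ l, |l| ≤ D ∧ Tendsto s F (nhds l) := by
  obtain ⟨l, hl, h⟩ := (isCompact_Icc (a := -D) (b := D)).ultrafilter_le_nhds' (F.map s)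
    (Ultrafilter.mem_map.2 (Filter.univ_mem' fun k => abs_le.1 (hs k)))
  exact ⟨l, abs_le.2 hl, h⟩

/-- Arzelà–Ascoli along an ultrafilter for periodic equi-Lipschitz functions. -/
lemma exists_uniform_ultralimit {N : ℕ} {ι : Type*} (F : Ultrafilter ι) {v : ι → Euc N → ℝ}
    {K : NNReal} {D : ℝ} (hL : ∀ k, LipschitzWith K (v k)) (hp : ∀ k, IsZPeriodic (v k))
    (hD : ∀ k x, |v k x| ≤ D) :
    ∃ u : Euc N → ℝ, LipschitzWith K u ∧ IsZPeriodic u ∧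
      ∀ η > 0, ∀ᶠ k in (F : Filter ι), ∀ x, |v k x - u x| ≤ η := by
  choose u _ hu using fun x => exists_tendsto_ultrafilter F (fun k => hD k x)
  have huL : LipschitzWith K u := by
    refine LipschitzWith.of_dist_le_mul fun x y => ?_
    exact le_of_tendsto ((hu x).dist (hu y)) (Eventually.of_forall fun k => (hL k).dist_le_mul x y)
  have hup : IsZPeriodic u := fun x z =>
    tendsto_nhds_unique (hu (x + intVec z)) (by simpa only [hp _ x z] using hu x)
  refine ⟨u, huL, hup, fun η hη => ?_⟩
  have hK : (0 : ℝ) ≤ K := K.2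
  set r : ℝ := η / (4 * (K + 1)) with hr
  have hr0 : 0 < r := by positivity
  have hKr : K * r ≤ η / 4 := by
    have : (K + 1) * r = η / 4 := by rw [hr]; field_simp
    linarith
  obtain ⟨t, -, ht, hcov⟩ := (isCompact_closedBall (0 : Euc N) (N + 1)).finite_cover_balls hr0
  have hev : ∀ᶠ k in (F : Filter ι), ∀ y ∈ t, |v k y - u y| < η / 2 :=
    (Filter.eventually_all_finite ht).2 fun y _ => by
      simpa only [Real.dist_eq] using Metric.tendsto_nhds.1 (hu y) (η / 2) (half_pos hη)
  filter_upwards [hev] with k hk x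
  obtain ⟨z, hz⟩ := exists_norm_add_intVec_le x
  rw [← hp k x z, ← hup x z]
  obtain ⟨y, hy, hxy⟩ := mem_iUnion₂.1 (hcov (show x + intVec z ∈ _ by simpa using hz))
  have hxy : dist (x + intVec z) y < r := hxy
  have h1 := (hL k).dist_le_mul (x + intVec z) y
  have h2 := huL.dist_le_mul (x + intVec z) y
  have h3 := hk y hy
  rw [Real.dist_eq, abs_le] at h1 h2
  rw [abs_lt] at h3
  have h4 : K * dist (x + intVec z) y ≤ η / 4 :=
    (mul_le_mul_of_nonneg_left hxy.le hK).trans hKr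
  rw [abs_le]
  constructor <;> linarith [h1.1, h1.2, h2.1, h2.2, h3.1, h3.2]

lemma superDiff_sub_const {N : ℕ} {u : Euc N → ℝ} {c : ℝ} {x q : Euc N}
    (hq : q ∈ superDiff (fun y => u y - c) x) : q ∈ superDiff u x := by
  obtain ⟨φ, h1, h2, h3, rfl⟩ := hq
  exact ⟨φ, h1, h2, fun y => by linarith [h3 y], rfl⟩

lemma subDiff_sub_const {N : ℕ} {u : Euc N → ℝ} {c : ℝ} {x q : Euc N}
    (hq : q ∈ subDiff (fun y => u y - c) x) : q ∈ subDiff u x := by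
  obtain ⟨φ, h1, h2, h3, rfl⟩ := hq
  exact ⟨φ, h1, h2, fun y => by linarith [h3 y], rfl⟩

/-- Solvability of the cell problem for coercive Hamiltonians. -/
theorem exists_isCellSolution {N : ℕ} {H : Euc N → Euc N → ℝ}
    (hH : Continuous fun q : Euc N × Euc N => H q.1 q.2) (hHp : IsZPeriodicH H)
    (hco : IsCoerciveH H) (P : Euc N) : ∃ (a : ℝ) (u : Euc N → ℝ), IsCellSolution H P u a := by
  set G : Euc N → Euc N → ℝ := fun x p => H x (p + P) with hGdef
  have hG : Continuous fun q : Euc N × Euc N => G q.1 q.2 :=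
    hH.comp (continuous_fst.prodMk (continuous_snd.add continuous_const))
  have hGp : IsZPeriodicH G := fun x p z => hHp x (p + P) z
  have hG0 : Continuous fun x => |G x 0| :=
    (hG.comp (continuous_id.prodMk continuous_const)).abs
  have hG0p : IsZPeriodic fun x => |G x 0| := fun x z => by simp only [hGp x 0 z]
  obtain ⟨x₀, hx₀⟩ := hG0p.exists_forall_le hG0
  set C := |G x₀ 0| with hC
  obtain ⟨r, hr⟩ := hco C
  set K : NNReal := (r + ‖P‖).toNNReal with hKdef
  have hK : ∀ x p, (K : ℝ) ≤ ‖p‖ → C ≤ G x p := by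
    intro x p hp
    refine hr x (p + P) ?_
    have h1 : r + ‖P‖ ≤ K := Real.le_coe_toNNReal _
    have h2 : ‖p‖ ≤ ‖p + P‖ + ‖P‖ := by simpa using norm_sub_le (p + P) P
    linarith
  have hμ : ∀ k : ℕ, (0 : ℝ) < 1 / (k + 1) := fun k => Nat.one_div_pos_of_nat
  choose u huL hup hub husub husup using fun k : ℕ =>
    exists_discounted_solution hG hGp hx₀ hK (hμ k)
  set F : Ultrafilter ℕ := hyperfilter ℕ with hF
  obtain ⟨a', -, ha'⟩ := exists_tendsto_ultrafilter F (fun k : ℕ => hub k 0)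
  set D : ℝ := K * (N + 1) with hDdef
  have hD : ∀ k x, |u k x - u k 0| ≤ D := by
    intro k x
    obtain ⟨z, hz⟩ := exists_norm_add_intVec_le x
    rw [← hup k x z]
    have h := (huL k).dist_le_mul (x + intVec z) 0
    rw [Real.dist_eq, dist_zero_right] at h
    exact h.trans (mul_le_mul_of_nonneg_left hz K.2)
  have hvL : ∀ k, LipschitzWith K fun x => u k x - u k 0 := fun k =>
    LipschitzWith.of_dist_le_mul fun x y => by
      simpa [Real.dist_eq] using (huL k).dist_le_mul x y
  have hvp : ∀ k, IsZPeriodic fun x => u k x - u k 0 := fun k x z => by simp only [hup k x z]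
  obtain ⟨w, hwL, hwp, hconv⟩ := exists_uniform_ultralimit F hvL hvp hD
  have hclose : ∀ e > 0, ∀ᶠ k : ℕ in (F : Filter ℕ), ∀ x, |1 / ((k : ℝ) + 1) * u k x - a'| ≤ e := by
    intro e he
    have h1 := Metric.tendsto_nhds.1 ha' (e / 2) (half_pos he)
    have h2 : Tendsto (fun k : ℕ => 1 / ((k : ℝ) + 1) * D) F (nhds 0) := by
      simpa using ((tendsto_one_div_add_atTop_nhds_zero_nat (𝕜 := ℝ)).mul_const D).mono_left
        (Nat.hyperfilter_le_atTop)
    have h3 := h2.eventually (gt_mem_nhds (half_pos he))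
    filter_upwards [h1, h3] with k hk1 hk3 x
    rw [Real.dist_eq, abs_lt] at hk1
    have h4 : |1 / ((k : ℝ) + 1) * (u k x - u k 0)| ≤ 1 / ((k : ℝ) + 1) * D := by
      rw [abs_mul, abs_of_pos (hμ k)]
      exact mul_le_mul_of_nonneg_left (hD k x) (hμ k).le
    rw [mul_sub, abs_le] at h4
    rw [abs_le]
    constructor <;> linarith [h4.1, h4.2, hk1.1, hk1.2]
  refine ⟨-a', w, ⟨K, hwL⟩, hwp, fun x q hq => ?_, fun x q hq => ?_⟩
  · refine level_le_of_uniform_limit (F := (F : Filter ℕ)) hG hwL.continuous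
      (fun k => (hvL k).continuous) hvp hconv (fun e he => ?_) x q hq
    filter_upwards [hclose e he] with k hk y p hp
    have := husub k y p (superDiff_sub_const hp)
    linarith [(abs_le.1 (hk y)).1]
  · have hG' : Continuous fun q : Euc N × Euc N => -G q.1 (-q.2) :=
      (hG.comp (continuous_fst.prodMk continuous_snd.neg)).neg
    have h := level_le_of_uniform_limit (F := (F : Filter ℕ)) (G := fun x p => -G x (-p)) (a := a')
      (v := fun k x => -(u k x - u k 0)) hG' hwL.continuous.neg
      (fun k => (hvL k).continuous.neg) (fun k x z => by simp only [hup k x z])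
      (fun η hη => by
        filter_upwards [hconv η hη] with k hk x
        rw [← abs_neg]
        simpa [sub_eq_add_neg, add_comm, add_left_comm] using hk x)
      (fun e he => by
        filter_upwards [hclose e he] with k hk y p hp
        have := husup k y (-p) (subDiff_sub_const (mem_subDiff_of_neg hp))
        linarith [(abs_le.1 (hk y)).2]) x (-q) (mem_superDiff_neg hq)
    simp only [neg_neg] at h
    change -a' ≤ G x q
    linarith

/-- The levels at which the cell problem has a Lipschitz periodic subsolution. -/
def subLevels {N : ℕ} (H : Euc N → Euc N → ℝ) (P : Euc N) : Set ℝ :=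
  {a | ∃ (u : Euc N → ℝ) (K : NNReal), LipschitzWith K u ∧ IsZPeriodic u ∧
    IsCellSubsolution H P a u}

lemma nonneg_of_mem_subLevels {N : ℕ} {H : Euc N → Euc N → ℝ} (hH : ∀ x p, 0 ≤ H x p)
    {P : Euc N} {a : ℝ} (ha : a ∈ subLevels H P) : 0 ≤ a := by
  obtain ⟨u, K, h1, h2, h3⟩ := ha
  obtain ⟨x, hx⟩ := h2.exists_forall_le h1.continuous
  exact (hH _ _).trans (h3 x 0 (zero_mem_superDiff hx))

lemma mem_subLevels_of_le {N : ℕ} {H : Euc N → Euc N → ℝ} {s : ℝ} (hH : ∀ x p, H x p ≤ s)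
    (P : Euc N) : s ∈ subLevels H P :=
  ⟨fun _ => 0, 0, LipschitzWith.const _, fun _ _ => rfl, fun _ _ _ => hH _ _⟩

lemma add_mem_subLevels {N : ℕ} {H : Euc N → Euc N → ℝ} {M : ℝ}
    (hH : ∀ x p p', H x p' ≤ H x p + M * ‖p' - p‖) {P P' : Euc N} {a : ℝ}
    (ha : a ∈ subLevels H P) : a + M * ‖P' - P‖ ∈ subLevels H P' := by
  obtain ⟨u, K, h1, h2, h3⟩ := ha
  refine ⟨u, K, h1, h2, fun x q hq => ?_⟩
  have h := hH x (q + P) (q + P')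
  rw [add_sub_add_left_eq_sub] at h
  linarith [h3 x q hq]

/-- The critical values of approximating Hamiltonians are locally uniformly bounded above by the
infimum of the subsolution levels of the limit. -/
lemma critical_le_sInf_subLevels {N : ℕ} {H : Euc N → Euc N → ℝ} {M s : ℝ} (hM : 0 < M)
    (hH0 : ∀ x p, 0 ≤ H x p) (hHs : ∀ x p, H x p ≤ s)
    (hHM : ∀ x p p', H x p' ≤ H x p + M * ‖p' - p‖)
    {Hn : ℕ → Euc N → Euc N → ℝ} {c : ℕ → Euc N → ℝ}
    (hcont : ∀ n, Continuous fun q : Euc N × Euc N => Hn n q.1 q.2)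
    (hA3 : ∀ R > (0:ℝ), ∀ ε > (0:ℝ), ∃ M : ℕ, ∀ n ≥ M, ∀ x p : Euc N, ‖p‖ ≤ R →
      -ε ≤ H x p - Hn n x p)
    (hsol : ∀ n P, ∃ u : Euc N → ℝ, IsCellSolution (Hn n) P u (c n P))
    (R : ℝ) {ε : ℝ} (hε : 0 < ε) :
    ∃ n₀ : ℕ, ∀ n ≥ n₀, ∀ P : Euc N, ‖P‖ ≤ R → c n P ≤ sInf (subLevels H P) + ε := by
  have hbdd : ∀ P, BddBelow (subLevels H P) := fun P =>
    ⟨0, fun a ha => nonneg_of_mem_subLevels hH0 ha⟩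
  suffices h : ∃ n₀ : ℕ, ∀ n ≥ n₀, ∀ P ∈ Metric.closedBall (0 : Euc N) R,
      c n P ≤ sInf (subLevels H P) + ε by simpa using h
  refine (isCompact_closedBall (0 : Euc N) R).induction_on
    (p := fun t => ∃ n₀ : ℕ, ∀ n ≥ n₀, ∀ P ∈ t, c n P ≤ sInf (subLevels H P) + ε)
    ⟨0, by simp⟩ ?_ ?_ ?_
  · rintro t t' htt' ⟨n₀, h⟩
    exact ⟨n₀, fun n hn P hP => h n hn P (htt' hP)⟩
  · rintro t t' ⟨n₀, h⟩ ⟨n₁, h'⟩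
    exact ⟨max n₀ n₁, fun n hn P hP => hP.elim (h n (le_of_max_le_left hn) P)
      (h' n (le_of_max_le_right hn) P)⟩
  intro P₀ _
  obtain ⟨a, ha, hlt⟩ := exists_lt_of_csInf_lt ⟨s, mem_subLevels_of_le hHs P₀⟩
    (show sInf (subLevels H P₀) < sInf (subLevels H P₀) + ε / 4 by linarith)
  obtain ⟨u, K, h1, h2, h3⟩ := ha
  set δ := min 1 (ε / (4 * M)) with hδ
  have hδ0 : 0 < δ := by positivity
  have hMδ : M * δ ≤ ε / 4 := by
    have : M * (ε / (4 * M)) = ε / 4 := by field_simp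
    rw [← this]
    exact mul_le_mul_of_nonneg_left (min_le_right _ _) hM.le
  have hK : (0 : ℝ) ≤ K := K.2
  obtain ⟨n₀, hn₀⟩ := hA3 (K + ‖P₀‖ + 1) (by positivity) (ε / 4) (by positivity)
  refine ⟨Metric.ball P₀ δ, mem_nhdsWithin_of_mem_nhds (Metric.ball_mem_nhds _ hδ0), n₀,
    fun n hn P hP => ?_⟩
  rw [Metric.mem_ball, dist_eq_norm] at hP
  have hMP : M * ‖P - P₀‖ ≤ ε / 4 := (mul_le_mul_of_nonneg_left hP.le hM.le).trans hMδ
  have hinf : sInf (subLevels H P₀) ≤ sInf (subLevels H P) + ε / 4 := by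
    rw [← sub_le_iff_le_add]
    refine le_csInf ⟨s, mem_subLevels_of_le hHs P⟩ fun b hb => ?_
    have := csInf_le (hbdd P₀) (add_mem_subLevels hHM (P' := P₀) hb)
    rw [norm_sub_rev] at this
    linarith
  obtain ⟨v, ⟨K', hv⟩, hvp, -, hvsup⟩ := hsol n P
  refine level_le_of_sub_super (hcont n) h1 h2 hv.continuous hvp (fun x q hq => ?_) hvsup
  have hP1 : ‖P‖ ≤ ‖P₀‖ + 1 := by
    have h4 : ‖P‖ ≤ ‖P₀‖ + ‖P - P₀‖ := by simpa using norm_add_le P₀ (P - P₀)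
    have : δ ≤ 1 := min_le_left _ _
    linarith
  have hqP : ‖q + P‖ ≤ K + ‖P₀‖ + 1 :=
    (norm_add_le _ _).trans (by linarith [norm_le_of_mem_superDiff h1 hq])
  have h5 := hn₀ n hn x (q + P) hqP
  have h6 := hHM x (q + P₀) (q + P)
  rw [add_sub_add_left_eq_sub] at h6
  linarith [h3 x q hq]

/-- A uniform bound below for the critical values of approximating Hamiltonians. -/
lemma sInf_subLevels_le_critical {N : ℕ} {H G : Euc N → Euc N → ℝ} (hH0 : ∀ x p, 0 ≤ H x p)
    {ε : ℝ} (hHG : ∀ x p, H x p - G x p ≤ ε) {P : Euc N} {a : ℝ} {u : Euc N → ℝ}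
    (hu : IsCellSolution G P u a) : sInf (subLevels H P) ≤ a + ε := by
  obtain ⟨⟨K, h1⟩, h2, h3, -⟩ := hu
  exact csInf_le ⟨0, fun a ha => nonneg_of_mem_subLevels hH0 ha⟩
    ⟨u, K, h1, h2, fun x q hq => by linarith [h3 x q hq, hHG x (q + P)]⟩

/-- A bounded-below Hamiltonian becomes coercive after adding `max (|p| - n) 0`. -/
lemma isCoerciveH_add_max {N : ℕ} {H : Euc N → Euc N → ℝ} (hH0 : ∀ x p, 0 ≤ H x p) (n : ℝ) :
    IsCoerciveH fun x p => H x p + max (‖p‖ - n) 0 := fun C =>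
  ⟨C + n, fun x p hp => by linarith [hH0 x p, le_max_left (‖p‖ - n) 0]⟩

/-- Existence and uniqueness of the generalized effective Hamiltonian
`H̄_∞`, as the limit of effective Hamiltonians of approximating coercive
Hamiltonians satisfying (A1)–(A4), for `H(x,p) = σ(x) m(|p|)`. -/
theorem generalized_effective_hamiltonian {N : ℕ} (hN : 1 ≤ N)
    (σ : Euc N → ℝ) (m : ℝ → ℝ) (L : NNReal)
    (hσc : Continuous σ) (hσp : IsZPeriodic σ) (hσpos : ∀ x, 0 < σ x)
    (hm01 : ∀ r : ℝ, 0 ≤ r → 0 < m r ∧ m r < 1)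
    (hmLip : LipschitzOnWith L m (Set.Ici 0))
    (hmmono : StrictMonoOn m (Set.Ici 0))
    (hmlim : Tendsto m atTop (nhds 1)) :
    ∃! Hinf : Euc N → ℝ,
      ∀ (Hn : ℕ → Euc N → Euc N → ℝ) (c : ℕ → Euc N → ℝ),
        -- (A1) continuity
        (∀ n, Continuous fun q : Euc N × Euc N => Hn n q.1 q.2) →
        (∀ n, IsZPeriodicH (Hn n)) →
        -- (A2) coercivity
        (∀ n, IsCoerciveH (Hn n)) →
        -- (A3) liminf_n inf_{x, ‖p‖ ≤ R} (H - H_n) ≥ 0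
        (∀ R > (0:ℝ), ∀ ε > (0:ℝ), ∃ M : ℕ, ∀ n ≥ M, ∀ x p : Euc N, ‖p‖ ≤ R →
            -ε ≤ σ x * m ‖p‖ - Hn n x p) →
        -- (A4) limsup_n sup (H - H_n) ≤ 0
        (∀ ε > (0:ℝ), ∃ M : ℕ, ∀ n ≥ M, ∀ x p : Euc N,
            σ x * m ‖p‖ - Hn n x p ≤ ε) →
        -- c n P is the critical value of the cell problem for H_n
        (∀ n P, ∃ u : Euc N → ℝ, IsCellSolution (Hn n) P u (c n P)) →
        -- conclusions: liminf inf ≥ 0, limsup sup ≤ 0, pointwise convergence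
        ((∀ R > (0:ℝ), ∀ ε > (0:ℝ), ∃ M : ℕ, ∀ n ≥ M, ∀ P : Euc N, ‖P‖ ≤ R →
            -ε ≤ Hinf P - c n P) ∧
         (∀ ε > (0:ℝ), ∃ M : ℕ, ∀ n ≥ M, ∀ P : Euc N, Hinf P - c n P ≤ ε) ∧
         (∀ P : Euc N, Tendsto (fun n => c n P) atTop (nhds (Hinf P)))) := by
  set H : Euc N → Euc N → ℝ := fun x p => σ x * m ‖p‖ with hH
  obtain ⟨x₀, hx₀⟩ := hσp.exists_forall_le hσc
  set s := σ x₀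
  have hs : 0 < s := hσpos x₀
  have hH0 : ∀ x p, 0 ≤ H x p := fun x p =>
    mul_nonneg (hσpos x).le (hm01 _ (norm_nonneg p)).1.le
  have hHs : ∀ x p, H x p ≤ s := fun x p => by
    have h1 := hm01 _ (norm_nonneg p)
    have h2 := hσpos x
    have h3 := hx₀ x
    simp only [hH]
    nlinarith
  have hHM : ∀ x p p', H x p' ≤ H x p + (s * L + 1) * ‖p' - p‖ := by
    intro x p p'
    have h1 := hmLip.dist_le_mul _ (norm_nonneg p') _ (norm_nonneg p)
    rw [Real.dist_eq, Real.dist_eq] at h1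
    have h2 : (L : ℝ) * |‖p'‖ - ‖p‖| ≤ L * ‖p' - p‖ :=
      mul_le_mul_of_nonneg_left (abs_norm_sub_norm_le p' p) L.2
    have h3 : m ‖p'‖ - m ‖p‖ ≤ L * ‖p' - p‖ := (le_abs_self _).trans (h1.trans h2)
    have h4 : σ x * (m ‖p'‖ - m ‖p‖) ≤ σ x * (L * ‖p' - p‖) :=
      mul_le_mul_of_nonneg_left h3 (hσpos x).le
    have h5 : σ x * (L * ‖p' - p‖) ≤ s * (L * ‖p' - p‖) :=
      mul_le_mul_of_nonneg_right (hx₀ x) (by positivity)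
    simp only [hH]
    nlinarith [norm_nonneg (p' - p)]
  have hHc : Continuous fun q : Euc N × Euc N => H q.1 q.2 := by
    have hmc : Continuous fun p : Euc N => m ‖p‖ :=
      hmLip.continuousOn.comp_continuous continuous_norm norm_nonneg
    exact (hσc.comp continuous_fst).mul (hmc.comp continuous_snd)
  have hHper : IsZPeriodicH H := fun x p z => by simp only [hH, hσp x z]
  have hmain :
      ∀ (Hn : ℕ → Euc N → Euc N → ℝ) (c : ℕ → Euc N → ℝ),
        (∀ n, Continuous fun q : Euc N × Euc N => Hn n q.1 q.2) →
        (∀ n, IsZPeriodicH (Hn n)) →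
        (∀ n, IsCoerciveH (Hn n)) →
        (∀ R > (0:ℝ), ∀ ε > (0:ℝ), ∃ M : ℕ, ∀ n ≥ M, ∀ x p : Euc N, ‖p‖ ≤ R →
            -ε ≤ H x p - Hn n x p) →
        (∀ ε > (0:ℝ), ∃ M : ℕ, ∀ n ≥ M, ∀ x p : Euc N,
            H x p - Hn n x p ≤ ε) →
        (∀ n P, ∃ u : Euc N → ℝ, IsCellSolution (Hn n) P u (c n P)) →
        ((∀ R > (0:ℝ), ∀ ε > (0:ℝ), ∃ M : ℕ, ∀ n ≥ M, ∀ P : Euc N, ‖P‖ ≤ R →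
            -ε ≤ sInf (subLevels H P) - c n P) ∧
         (∀ ε > (0:ℝ), ∃ M : ℕ, ∀ n ≥ M, ∀ P : Euc N, sInf (subLevels H P) - c n P ≤ ε) ∧
         (∀ P : Euc N, Tendsto (fun n => c n P) atTop (nhds (sInf (subLevels H P))))) := by
    intro Hn c hcont _ _ hA3 hA4 hsol
    have hup : ∀ R > (0:ℝ), ∀ ε > (0:ℝ), ∃ M : ℕ, ∀ n ≥ M, ∀ P : Euc N, ‖P‖ ≤ R →
        -ε ≤ sInf (subLevels H P) - c n P := by
      intro R _ ε hε
      obtain ⟨n₀, h⟩ := critical_le_sInf_subLevels (M := s * L + 1) (by positivity) hH0 hHs hHM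
        hcont hA3 hsol R hε
      exact ⟨n₀, fun n hn P hP => by linarith [h n hn P hP]⟩
    have hlow : ∀ ε > (0:ℝ), ∃ M : ℕ, ∀ n ≥ M, ∀ P : Euc N,
        sInf (subLevels H P) - c n P ≤ ε := by
      intro ε hε
      obtain ⟨n₀, h⟩ := hA4 ε hε
      refine ⟨n₀, fun n hn P => ?_⟩
      obtain ⟨u, hu⟩ := hsol n P
      linarith [sInf_subLevels_le_critical hH0 (h n hn) hu]
    refine ⟨hup, hlow, fun P => Metric.tendsto_atTop.2 fun ε hε => ?_⟩
    obtain ⟨n₀, h₀⟩ := hup (‖P‖ + 1) (by positivity) (ε / 2) (half_pos hε)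
    obtain ⟨n₁, h₁⟩ := hlow (ε / 2) (half_pos hε)
    refine ⟨max n₀ n₁, fun n hn => ?_⟩
    have h2 := h₀ n (le_of_max_le_left hn) P (by linarith)
    have h3 := h₁ n (le_of_max_le_right hn) P
    rw [Real.dist_eq, abs_lt]
    constructor <;> linarith
  refine ⟨fun P => sInf (subLevels H P), hmain, fun H' hH' => ?_⟩
  set Hn : ℕ → Euc N → Euc N → ℝ := fun n x p => H x p + max (‖p‖ - n) 0 with hHn
  have hcont : ∀ n, Continuous fun q : Euc N × Euc N => Hn n q.1 q.2 := fun n =>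
    hHc.add (((continuous_norm.comp continuous_snd).sub continuous_const).max continuous_const)
  have hper : ∀ n, IsZPeriodicH (Hn n) := fun n x p z => by simp only [hHn, hHper x p z]
  have hco : ∀ n, IsCoerciveH (Hn n) := fun n => isCoerciveH_add_max hH0 n
  choose c hc using fun n P => exists_isCellSolution (hcont n) (hper n) (hco n) P
  have hA3 : ∀ R > (0:ℝ), ∀ ε > (0:ℝ), ∃ M : ℕ, ∀ n ≥ M, ∀ x p : Euc N, ‖p‖ ≤ R →
      -ε ≤ H x p - Hn n x p := by
    intro R _ ε hε
    obtain ⟨n₀, hn₀⟩ := exists_nat_ge R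
    refine ⟨n₀, fun n hn x p hp => ?_⟩
    have hn' : (n₀ : ℝ) ≤ n := by exact_mod_cast hn
    simp only [hHn, max_eq_right (show ‖p‖ - n ≤ 0 by linarith)]
    linarith
  have hA4 : ∀ ε > (0:ℝ), ∃ M : ℕ, ∀ n ≥ M, ∀ x p : Euc N, H x p - Hn n x p ≤ ε :=
    fun ε hε => ⟨0, fun n _ x p => by
      simp only [hHn]
      linarith [le_max_right (‖p‖ - n) 0]⟩
  exact funext fun P => tendsto_nhds_unique ((hH' Hn c hcont hper hco hA3 hA4 hc).2.2 P)
    ((hmain Hn c hcont hper hco hA3 hA4 hc).2.2 P)
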